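/- arXiv:2308.00509 — 2 statements merged into one kernel-verified Lean document; each statement's English description precedes it below -/
import Mathlib

section
/- (Hypercontractivity) For any f : {-1,1}^n → ℝ and ρ ∈ [0,1], ‖T_ρ f‖_2 ≤ ‖f‖_{1+ρ²}, where T_ρ f = ∑_S ρ^{|S|} f̂(S) X_S and ‖f‖_p = (E_x |f(x)|^p)^{1/p} with x uniform on {-1,1}^n. -/
open Finset

noncomputable def bSgn (b : Bool) : ℝ := if b then 1 else -1

noncomputable def bChi {n : ℕ} (S : Finset (Fin n)) (x : Fin n → Bool) : ℝ :=
  ∏ i ∈ S, bSgn (x i)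

noncomputable def bExpect {n : ℕ} (g : (Fin n → Bool) → ℝ) : ℝ :=
  (∑ x : Fin n → Bool, g x) / 2 ^ n

noncomputable def bFourier {n : ℕ} (f : (Fin n → Bool) → ℝ) (S : Finset (Fin n)) : ℝ :=
  bExpect fun x => f x * bChi S x

def bFlip1 {n : ℕ} (k : Fin n) (x : Fin n → Bool) : Fin n → Bool :=
  Function.update x k (!(x k))

def bFlipS {n : ℕ} (T : Finset (Fin n)) (x : Fin n → Bool) : Fin n → Bool :=
  fun i => if i ∈ T then !(x i) else x i

/-- combinatorial influence of bit `k` -/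
noncomputable def inflC {n : ℕ} (f : (Fin n → Bool) → ℝ) (k : Fin n) : ℝ :=
  bExpect fun x => if f x ≠ f (bFlip1 k x) then 1 else 0

/-- spectral influence of bit `k` -/
noncomputable def inflS {n : ℕ} (f : (Fin n → Bool) → ℝ) (k : Fin n) : ℝ :=
  ∑ S ∈ univ.filter (fun S : Finset (Fin n) => k ∈ S), bFourier f S ^ 2

/-- total influence (spectral form) -/
noncomputable def totInfl {n : ℕ} (f : (Fin n → Bool) → ℝ) : ℝ :=
  ∑ S : Finset (Fin n), (S.card : ℝ) * bFourier f S ^ 2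

/-- spectrum entropy, base 2; terms with zero coefficient contribute 0 -/
noncomputable def specEnt {n : ℕ} (f : (Fin n → Bool) → ℝ) : ℝ :=
  ∑ S : Finset (Fin n), bFourier f S ^ 2 * Real.logb 2 (1 / bFourier f S ^ 2)

/-- `f` is Boolean (±1)-valued -/
def IsBooleanFn {n : ℕ} (f : (Fin n → Bool) → ℝ) : Prop :=
  ∀ x, f x = 1 ∨ f x = -1

noncomputable def noiseOp {n : ℕ} (ρ : ℝ) (f : (Fin n → Bool) → ℝ) :
    (Fin n → Bool) → ℝ :=
  fun x => ∑ S : Finset (Fin n), ρ ^ S.card * bFourier f S * bChi S x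

lemma hc_d1 (q y : ℝ) (hq0 : 0 ≤ q) (hq1 : q ≤ 1) (hy0 : 0 ≤ y) (hy1 : y ≤ 1) :
    2 * q * y ≤ (1 + y) ^ q - (1 - y) ^ q := by
  have hm : MonotoneOn (fun y : ℝ => (1 + y) ^ q - (1 - y) ^ q - 2 * q * y) (Set.Icc 0 1) := by
    have hd : ∀ x ∈ interior (Set.Icc (0:ℝ) 1),
        HasDerivAt (fun y : ℝ => (1 + y) ^ q - (1 - y) ^ q - 2 * q * y)
          (1 * q * (1 + x) ^ (q - 1) - (-1) * q * (1 - x) ^ (q - 1) - 2 * q * 1) x := by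
      intro x hx
      rw [interior_Icc] at hx
      obtain ⟨h0, h1⟩ := hx
      exact ((((hasDerivAt_id x).const_add 1).rpow_const (Or.inl (by simp; linarith))).sub
        (((hasDerivAt_id x).const_sub 1).rpow_const (Or.inl (by simp; linarith)))).sub
        ((hasDerivAt_id x).const_mul (2 * q))
    refine monotoneOn_of_deriv_nonneg (convex_Icc 0 1) ?_
      (fun x hx => (hd x hx).differentiableAt.differentiableWithinAt) ?_
    · refine Continuous.continuousOn ?_
      exact (((continuous_const.add continuous_id).rpow_const (fun _ => Or.inr hq0)).sub
        ((continuous_const.sub continuous_id).rpow_const (fun _ => Or.inr hq0))).sub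
        (continuous_const.mul continuous_id)
    · intro x hx
      rw [(hd x hx).deriv]
      rw [interior_Icc] at hx
      obtain ⟨h0, h1⟩ := hx
      have hA : 0 < (1 + x) ^ (q - 1) := Real.rpow_pos_of_pos (by linarith) _
      have hB : 0 < (1 - x) ^ (q - 1) := Real.rpow_pos_of_pos (by linarith) _
      have hAB : 1 ≤ (1 + x) ^ (q - 1) * (1 - x) ^ (q - 1) := by
        rw [← Real.mul_rpow (by linarith) (by linarith)]
        exact Real.one_le_rpow_of_pos_of_le_one_of_nonpos (by nlinarith) (by nlinarith)
          (by linarith)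
      have h2 : 2 ≤ (1 + x) ^ (q - 1) + (1 - x) ^ (q - 1) := by
        nlinarith [sq_nonneg ((1 + x) ^ (q - 1) - (1 - x) ^ (q - 1))]
      nlinarith
  have := hm (Set.left_mem_Icc.2 zero_le_one) ⟨hy0, hy1⟩ hy0
  simp at this
  linarith

lemma hc_d2 (q y : ℝ) (hq0 : 0 ≤ q) (hq1 : q ≤ 1) (hy0 : 0 ≤ y) (hy1 : y ≤ 1) :
    2 + (1 + q) * q * y ^ 2 ≤ (1 + y) ^ (1 + q) + (1 - y) ^ (1 + q) := by
  have hm : MonotoneOn (fun y : ℝ => (1 + y) ^ (1 + q) + (1 - y) ^ (1 + q)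
      - (1 + q) * q * y ^ 2) (Set.Icc 0 1) := by
    have hd : ∀ x ∈ interior (Set.Icc (0:ℝ) 1),
        HasDerivAt (fun y : ℝ => (1 + y) ^ (1 + q) + (1 - y) ^ (1 + q) - (1 + q) * q * y ^ 2)
          (1 * (1 + q) * (1 + x) ^ (1 + q - 1) + (-1) * (1 + q) * (1 - x) ^ (1 + q - 1)
            - (1 + q) * q * ((2:ℕ) * x ^ 1 * 1)) x := by
      intro x hx
      rw [interior_Icc] at hx
      obtain ⟨h0, h1⟩ := hx
      exact ((((hasDerivAt_id x).const_add 1).rpow_const (Or.inl (by simp; linarith))).add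
        (((hasDerivAt_id x).const_sub 1).rpow_const (Or.inl (by simp; linarith)))).sub
        (((hasDerivAt_id x).pow 2).const_mul ((1 + q) * q))
    refine monotoneOn_of_deriv_nonneg (convex_Icc 0 1) ?_
      (fun x hx => (hd x hx).differentiableAt.differentiableWithinAt) ?_
    · refine Continuous.continuousOn ?_
      have hq' : 0 ≤ 1 + q := by linarith
      exact (((continuous_const.add continuous_id).rpow_const (fun _ => Or.inr hq')).add
        ((continuous_const.sub continuous_id).rpow_const (fun _ => Or.inr hq'))).sub
        (continuous_const.mul (continuous_id.pow 2))
    · intro x hx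
      rw [(hd x hx).deriv]
      rw [interior_Icc] at hx
      obtain ⟨h0, h1⟩ := hx
      have := hc_d1 q x hq0 hq1 h0.le h1.le
      rw [add_sub_cancel_left]
      push_cast
      nlinarith
  have := hm (Set.left_mem_Icc.2 zero_le_one) ⟨hy0, hy1⟩ hy0
  simp at this
  linarith

lemma hc_two_aux (q a b : ℝ) (hq0 : 0 ≤ q) (hq1 : q ≤ 1) (hb : 0 ≤ b) (hab : b ≤ a) :
    (a ^ 2 + q * b ^ 2) ^ ((1 + q) / 2) ≤ (|a + b| ^ (1 + q) + |a - b| ^ (1 + q)) / 2 := by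
  rcases eq_or_lt_of_le (hb.trans hab) with h | ha
  · subst h
    have : b = 0 := le_antisymm hab hb
    subst this
    simp
    rw [Real.zero_rpow (by linarith), Real.zero_rpow (by linarith)]
  · obtain ⟨y, rfl⟩ : ∃ y, b = a * y := ⟨b / a, by field_simp⟩
    have hy0 : 0 ≤ y := by by_contra h; nlinarith
    have hy1 : y ≤ 1 := by by_contra h; nlinarith
    rw [show a + a * y = a * (1 + y) by ring, show a - a * y = a * (1 - y) by ring,
      abs_of_nonneg (by positivity), abs_of_nonneg (mul_nonneg ha.le (by linarith)),
      Real.mul_rpow ha.le (by linarith), Real.mul_rpow ha.le (by linarith),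
      show a ^ 2 + q * (a * y) ^ 2 = a ^ 2 * (1 + q * y ^ 2) by ring,
      Real.mul_rpow (by positivity) (by positivity), ← Real.rpow_natCast a 2, ← Real.rpow_mul ha.le]
    rw [show ((2:ℕ):ℝ) * ((1 + q) / 2) = 1 + q by push_cast; ring]
    have h1 := rpow_one_add_le_one_add_mul_self (s := q * y ^ 2) (p := (1 + q) / 2)
      (by nlinarith [mul_nonneg hq0 (sq_nonneg y)]) (by linarith) (by linarith)
    have h2 := hc_d2 q y hq0 hq1 hy0 hy1
    have h3 : 0 < a ^ (1 + q) := Real.rpow_pos_of_pos ha _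
    have : (1 + q * y ^ 2) ^ ((1 + q) / 2) ≤ ((1 + y) ^ (1 + q) + (1 - y) ^ (1 + q)) / 2 := by
      linarith
    nlinarith

lemma hc_two (q a b : ℝ) (hq0 : 0 ≤ q) (hq1 : q ≤ 1) :
    (a ^ 2 + q * b ^ 2) ^ ((1 + q) / 2) ≤ (|a + b| ^ (1 + q) + |a - b| ^ (1 + q)) / 2 := by
  have key : ∀ a b : ℝ, 0 ≤ a → 0 ≤ b →
      (a ^ 2 + q * b ^ 2) ^ ((1 + q) / 2) ≤ (|a + b| ^ (1 + q) + |a - b| ^ (1 + q)) / 2 := by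
    intro a b ha hb
    rcases le_total b a with h | h
    · exact hc_two_aux q a b hq0 hq1 hb h
    · refine le_trans ?_ ((hc_two_aux q b a hq0 hq1 ha h).trans_eq ?_)
      · apply Real.rpow_le_rpow (by positivity) _ (by positivity)
        nlinarith [mul_nonneg (sub_nonneg.2 hq1) (sub_nonneg.2 (pow_le_pow_left₀ ha h 2))]
      · rw [add_comm b a, abs_sub_comm b a]
  rcases le_total 0 a with ha | ha <;> rcases le_total 0 b with hb | hb
  · exact key a b ha hb
  · have := key a (-b) ha (by linarith)
    rw [neg_sq, ← sub_eq_add_neg, sub_neg_eq_add] at this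
    linarith
  · have := key (-a) b (by linarith) hb
    rw [neg_sq, show -a + b = -(a - b) by ring, show -a - b = -(a + b) by ring, abs_neg,
      abs_neg] at this
    linarith
  · have := key (-a) (-b) (by linarith) (by linarith)
    rw [neg_sq, neg_sq, show -a + -b = -(a + b) by ring, show -a - -b = -(a - b) by ring, abs_neg,
      abs_neg] at this
    linarith

lemma hc_mink {ι : Type*} (s : Finset ι) (U V : ι → ℝ) (r : ℝ) (hr : 1 ≤ r)
    (hU : ∀ i, 0 ≤ U i) (hV : ∀ i, 0 ≤ V i) :
    ((∑ i ∈ s, U i) ^ r + (∑ i ∈ s, V i) ^ r) ^ (1 / r)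
      ≤ ∑ i ∈ s, (U i ^ r + V i ^ r) ^ (1 / r) := by
  classical
  have hr0 : r ≠ 0 := by linarith
  induction s using Finset.induction_on with
  | empty => simp [Real.zero_rpow hr0, Real.zero_rpow (inv_ne_zero hr0)]
  | insert a s ha ih =>
    rw [sum_insert ha, sum_insert ha, sum_insert ha]
    have h := Real.Lp_add_le_of_nonneg (s := (univ : Finset (Fin 2)))
      (f := ![U a, V a]) (g := ![∑ i ∈ s, U i, ∑ i ∈ s, V i]) hr
      (by intro i _; fin_cases i <;> simp [hU, hV])
      (by intro i _; fin_cases i <;> simp [hU, hV, sum_nonneg])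
    simp only [Fin.sum_univ_two, Matrix.cons_val_zero, Matrix.cons_val_one] at h
    exact h.trans (by gcongr)

lemma hc_kernel {n : ℕ} (ρ : ℝ) (f : (Fin n → Bool) → ℝ) (x : Fin n → Bool) :
    noiseOp ρ f x = (∑ y, f y * ∏ i, (1 + ρ * bSgn (x i) * bSgn (y i))) / 2 ^ n := by
  unfold noiseOp bFourier bExpect bChi
  simp only [prod_one_add, powerset_univ, prod_mul_distrib, prod_const, mul_sum, sum_div, sum_mul]
  rw [sum_comm]
  refine sum_congr rfl fun y _ => sum_congr rfl fun S _ => ?_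
  ring

lemma hc_sum {n : ℕ} (F : (Fin (n + 1) → Bool) → ℝ) :
    ∑ x, F x = ∑ x : Fin n → Bool,
      (F (Fin.cons true x : Fin (n + 1) → Bool) + F (Fin.cons false x : Fin (n + 1) → Bool)) := by
  rw [← (Fin.consEquiv (fun _ : Fin (n + 1) => Bool)).sum_comp, Fintype.sum_prod_type,
    Fintype.sum_bool, sum_add_distrib]
  rfl

lemma hc_noise_cons {n : ℕ} (ρ : ℝ) (f : (Fin (n + 1) → Bool) → ℝ) (b : Bool)
    (x : Fin n → Bool) :
    noiseOp ρ f (Fin.cons b x : Fin (n + 1) → Bool) =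
      noiseOp ρ (fun y => (f (Fin.cons true y : Fin (n + 1) → Bool)
        + f (Fin.cons false y : Fin (n + 1) → Bool)) / 2) x
      + ρ * bSgn b * noiseOp ρ (fun y => (f (Fin.cons true y : Fin (n + 1) → Bool)
        - f (Fin.cons false y : Fin (n + 1) → Bool)) / 2) x := by
  rw [hc_kernel, hc_kernel, hc_kernel, hc_sum]
  simp only [Fin.prod_univ_succ, Fin.cons_zero, Fin.cons_succ, mul_div_assoc', mul_sum, ← add_div,
    ← sum_add_distrib, pow_succ]
  rw [← div_div, div_right_comm, sum_div]
  congr 1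
  refine sum_congr rfl fun y _ => ?_
  cases b <;> simp [bSgn] <;> ring

lemma hc_main (ρ : ℝ) (h0 : 0 ≤ ρ) (h1 : ρ ≤ 1) (n : ℕ) (f : (Fin n → Bool) → ℝ) :
    (bExpect fun x => noiseOp ρ f x ^ 2)
      ≤ (bExpect fun x => |f x| ^ (1 + ρ ^ 2)) ^ (2 / (1 + ρ ^ 2)) := by
  set q := ρ ^ 2 with hq
  have hq0 : 0 ≤ q := by positivity
  have hq1 : q ≤ 1 := by rw [hq]; nlinarith
  have hp : 0 < 1 + q := by linarith
  induction n with
  | zero =>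
    have : ∀ x, noiseOp ρ f x = f x := by
      intro x
      rw [hc_kernel]
      simp
      exact congrArg f (Subsingleton.elim _ _)
    simp only [this, bExpect]
    simp
    rw [← Real.rpow_mul (abs_nonneg _), mul_div_cancel₀ _ hp.ne']
    simp
  | succ n ih =>
    set g : (Fin n → Bool) → ℝ := fun y => (f (Fin.cons true y : Fin (n + 1) → Bool)
        + f (Fin.cons false y : Fin (n + 1) → Bool)) / 2 with hg
    set h : (Fin n → Bool) → ℝ := fun y => (f (Fin.cons true y : Fin (n + 1) → Bool)
        - f (Fin.cons false y : Fin (n + 1) → Bool)) / 2 with hh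
    have e1 : (bExpect fun x => noiseOp ρ f x ^ 2) =
        (bExpect fun x => noiseOp ρ g x ^ 2) + q * (bExpect fun x => noiseOp ρ h x ^ 2) := by
      simp only [bExpect]
      rw [hc_sum]
      simp only [hc_noise_cons, ← hg, ← hh, bSgn, mul_div_assoc', mul_sum, ← add_div,
        ← sum_add_distrib, pow_succ]
      rw [← div_div, div_right_comm, sum_div]
      congr 1
      refine sum_congr rfl fun y _ => ?_
      simp [hq]
      ring
    have hr : 1 ≤ 2 / (1 + q) := by rw [le_div_iff₀ hp]; linarith
    have hm := hc_mink univ (fun x => |g x| ^ (1 + q) / 2 ^ n) (fun x => |ρ * h x| ^ (1 + q) / 2 ^ n)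
      (2 / (1 + q)) hr (fun _ => by positivity) (fun _ => by positivity)
    have e2 : ∀ x, ((|g x| ^ (1 + q) / 2 ^ n) ^ (2 / (1 + q))
        + (|ρ * h x| ^ (1 + q) / 2 ^ n) ^ (2 / (1 + q))) ^ (1 / (2 / (1 + q)))
        = (g x ^ 2 + q * h x ^ 2) ^ ((1 + q) / 2) / 2 ^ n := by
      intro x
      rw [Real.div_rpow (by positivity) (by positivity), Real.div_rpow (by positivity) (by positivity),
        ← add_div, Real.div_rpow (by positivity) (by positivity), ← Real.rpow_mul (abs_nonneg _),
        ← Real.rpow_mul (abs_nonneg _), mul_div_cancel₀ _ hp.ne', one_div_div,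
        ← Real.rpow_mul (by positivity : (0:ℝ) ≤ 2 ^ n), div_mul_div_comm, mul_comm (1 + q) 2,
        div_self (by positivity), Real.rpow_one]
      simp [hq, mul_pow]
    have e3 : (bExpect fun x => |f x| ^ (1 + q)) =
        ∑ x, ((|g x + h x| ^ (1 + q) + |g x - h x| ^ (1 + q)) / 2) / 2 ^ n := by
      simp only [bExpect]
      rw [hc_sum, pow_succ, ← div_div, div_right_comm, sum_div, sum_div]
      refine sum_congr rfl fun y _ => ?_
      simp only [hg, hh]
      congr 5 <;> ring_nf
    have hle : ((∑ x, |g x| ^ (1 + q) / 2 ^ n) ^ (2 / (1 + q))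
        + (∑ x, |ρ * h x| ^ (1 + q) / 2 ^ n) ^ (2 / (1 + q))) ^ (1 / (2 / (1 + q)))
        ≤ bExpect fun x => |f x| ^ (1 + q) := by
      refine hm.trans ?_
      rw [e3]
      refine sum_le_sum fun x _ => ?_
      rw [e2]
      have := hc_two q (g x) (h x) hq0 hq1
      gcongr
    have hle2 := Real.rpow_le_rpow (by positivity) hle (by positivity : 0 ≤ 2 / (1 + q))
    rw [← Real.rpow_mul (by positivity), one_div_mul_cancel (by positivity), Real.rpow_one] at hle2
    refine le_trans ?_ hle2
    rw [e1]
    refine add_le_add ?_ ?_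
    · refine (ih g).trans_eq ?_
      simp only [bExpect, sum_div]
    · refine (mul_le_mul_of_nonneg_left (ih h) hq0).trans_eq ?_
      simp only [bExpect, abs_mul, Real.mul_rpow (abs_nonneg _) (abs_nonneg _), mul_div_assoc,
        ← mul_sum, sum_div]
      rw [Real.mul_rpow (by positivity) (sum_nonneg fun _ _ => by positivity),
        ← Real.rpow_mul (abs_nonneg _), mul_div_cancel₀ _ hp.ne']
      simp [hq]

theorem hypercontractivity (n : ℕ) (f : (Fin n → Bool) → ℝ) (ρ : ℝ)
    (hρ : ρ ∈ Set.Icc (0 : ℝ) 1) :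
    (bExpect fun x => |noiseOp ρ f x| ^ (2 : ℝ)) ^ ((2 : ℝ)⁻¹)
      ≤ (bExpect fun x => |f x| ^ (1 + ρ ^ 2)) ^ ((1 + ρ ^ 2)⁻¹) := by
  have hm := hc_main ρ hρ.1 hρ.2 n f
  have hn : 0 ≤ bExpect fun x => noiseOp ρ f x ^ 2 := by
    unfold bExpect; positivity
  have hn2 : 0 ≤ bExpect fun x => |f x| ^ (1 + ρ ^ 2) := by
    unfold bExpect; positivity
  have := Real.rpow_le_rpow hn hm (by norm_num : (0:ℝ) ≤ 2⁻¹)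
  rw [← Real.rpow_mul hn2] at this
  have e : 2 / (1 + ρ ^ 2) * 2⁻¹ = (1 + ρ ^ 2)⁻¹ := by
    have : 1 + ρ ^ 2 ≠ 0 := by positivity
    field_simp
  rw [e] at this
  simpa using this
end

section
/- For every δ > 0 there exists c > 0 such that every Boolean function f : {-1,1}^n → {-1,1} with I(f) > δ satisfies max_S |f̂(S)| ≥ exp(−c·I(f)²). -/
open Finset

lemma bSgn_sq (b : Bool) : bSgn b ^ 2 = 1 := by cases b <;> simp [bSgn]

lemma bSgn_not (b : Bool) : bSgn (!b) = - bSgn b := by cases b <;> simp [bSgn]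

lemma bFlip1_invol {n : ℕ} (k : Fin n) : Function.Involutive (bFlip1 k) := by
  intro x
  funext i
  by_cases h : i = k
  · subst h; simp [bFlip1]
  · simp [bFlip1, h]

lemma bExpect_flip {n : ℕ} (k : Fin n) (g : (Fin n → Bool) → ℝ) :
    bExpect (fun x => g (bFlip1 k x)) = bExpect g := by
  unfold bExpect
  congr 1
  exact Equiv.sum_comp (bFlip1_invol k).toPerm g

lemma bExpect_add {n : ℕ} (g h : (Fin n → Bool) → ℝ) :
    bExpect (fun x => g x + h x) = bExpect g + bExpect h := by
  unfold bExpect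
  rw [Finset.sum_add_distrib, add_div]

lemma bExpect_smul {n : ℕ} (c : ℝ) (g : (Fin n → Bool) → ℝ) :
    bExpect (fun x => c * g x) = c * bExpect g := by
  unfold bExpect
  rw [← Finset.mul_sum, mul_div_assoc]

lemma bExpect_const {n : ℕ} (c : ℝ) : bExpect (fun _ : Fin n → Bool => c) = c := by
  simp [bExpect]

lemma bExpect_nonneg {n : ℕ} (g : (Fin n → Bool) → ℝ) (h : ∀ x, 0 ≤ g x) : 0 ≤ bExpect g := by
  unfold bExpect
  exact div_nonneg (Finset.sum_nonneg fun x _ => h x) (by positivity)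

lemma bExpect_cs {n : ℕ} (g h : (Fin n → Bool) → ℝ) :
    bExpect (fun x => g x * h x) ^ 2 ≤ bExpect (fun x => g x ^ 2) * bExpect (fun x => h x ^ 2) := by
  unfold bExpect
  rw [div_pow, div_mul_div_comm, ← sq]
  gcongr
  exact Finset.sum_mul_sq_le_sq_mul_sq _ _ _

lemma bChi_flip_not_mem {n : ℕ} (k : Fin n) (S : Finset (Fin n)) (h : k ∉ S) (x : Fin n → Bool) :
    bChi S (bFlip1 k x) = bChi S x := by
  unfold bChi
  refine Finset.prod_congr rfl fun i hi => ?_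
  have : i ≠ k := fun e => h (e ▸ hi)
  simp [bFlip1, this]

lemma bChi_insert {n : ℕ} (k : Fin n) (S : Finset (Fin n)) (h : k ∉ S) (x : Fin n → Bool) :
    bChi (insert k S) x = bSgn (x k) * bChi S x := by
  unfold bChi
  rw [Finset.prod_insert h]

lemma bChi_flip_mem {n : ℕ} (k : Fin n) (S : Finset (Fin n)) (h : k ∈ S) (x : Fin n → Bool) :
    bChi S (bFlip1 k x) = - bChi S x := by
  rw [← Finset.insert_erase h, bChi_insert _ _ (Finset.notMem_erase k S),
    bChi_insert _ _ (Finset.notMem_erase k S), bChi_flip_not_mem _ _ (Finset.notMem_erase k S)]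
  have : bFlip1 k x k = !(x k) := by simp [bFlip1]
  rw [this, bSgn_not]; ring

lemma bExpect_odd {n : ℕ} (k : Fin n) (h : (Fin n → Bool) → ℝ)
    (hh : ∀ x, h (bFlip1 k x) = h x) : bExpect (fun x => bSgn (x k) * h x) = 0 := by
  have h1 := bExpect_flip k (fun x => bSgn (x k) * h x)
  have h2 : (fun x => bSgn (bFlip1 k x k) * h (bFlip1 k x))
      = fun x => (-1 : ℝ) * (bSgn (x k) * h x) := by
    funext x
    have : bFlip1 k x k = !(x k) := by simp [bFlip1]
    rw [this, bSgn_not, hh]; ring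
  rw [h2, bExpect_smul] at h1
  linarith

lemma bonami {n : ℕ} (T : Finset (Fin n)) : ∀ a : Finset (Fin n) → ℝ,
    bExpect (fun x => (∑ S ∈ T.powerset, a S * bChi S x) ^ 4)
      ≤ (∑ S ∈ T.powerset, 3 ^ S.card * a S ^ 2) ^ 2 := by
  induction T using Finset.induction_on with
  | empty =>
    intro a
    simp only [Finset.powerset_empty, Finset.sum_singleton, bChi, Finset.prod_empty,
      bExpect_const, Finset.card_empty]
    apply le_of_eq; ring
  | insert k T hk ih =>
    intro a
    have hS : ∀ S ∈ T.powerset, k ∉ S := fun S hS hkS => hk (Finset.mem_powerset.1 hS hkS)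
    set u : (Fin n → Bool) → ℝ := fun x => ∑ S ∈ T.powerset, a S * bChi S x with hu
    set v : (Fin n → Bool) → ℝ := fun x => ∑ S ∈ T.powerset, a (insert k S) * bChi S x with hv
    have hA := ih a
    have hB := ih (fun S => a (insert k S))
    set A := ∑ S ∈ T.powerset, 3 ^ S.card * a S ^ 2 with hAdef
    set B := ∑ S ∈ T.powerset, 3 ^ S.card * a (insert k S) ^ 2 with hBdef
    have hA0 : 0 ≤ A := Finset.sum_nonneg fun S _ => by positivity
    have hB0 : 0 ≤ B := Finset.sum_nonneg fun S _ => by positivity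
    have huf : ∀ x, u (bFlip1 k x) = u x := fun x =>
      Finset.sum_congr rfl fun S h => by rw [bChi_flip_not_mem _ _ (hS S h)]
    have hvf : ∀ x, v (bFlip1 k x) = v x := fun x =>
      Finset.sum_congr rfl fun S h => by rw [bChi_flip_not_mem _ _ (hS S h)]
    have e1 : (∑ S ∈ (insert k T).powerset, 3 ^ S.card * a S ^ 2) = A + 3 * B := by
      rw [Finset.sum_powerset_insert hk, hBdef, Finset.mul_sum]
      congr 1
      refine Finset.sum_congr rfl fun S h => ?_
      rw [Finset.card_insert_of_notMem (hS S h)]; ring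
    have e2 : (fun x => (∑ S ∈ (insert k T).powerset, a S * bChi S x) ^ 4)
        = fun x => (u x ^ 4 + 6 * (u x ^ 2 * v x ^ 2) + v x ^ 4)
          + bSgn (x k) * (4 * u x ^ 3 * v x + 4 * u x * v x ^ 3) := by
      funext x
      have : ∑ S ∈ (insert k T).powerset, a S * bChi S x = u x + bSgn (x k) * v x := by
        rw [Finset.sum_powerset_insert hk, hv, Finset.mul_sum]
        congr 1
        refine Finset.sum_congr rfl fun S h => ?_
        rw [bChi_insert _ _ (hS S h)]; ring
      rw [this]
      linear_combination (6 * u x ^ 2 * v x ^ 2 + 4 * u x * v x ^ 3 * bSgn (x k)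
        + v x ^ 4 * (bSgn (x k) ^ 2 + 1)) * bSgn_sq (x k)
    rw [e1, e2, bExpect_add, bExpect_odd k _ (fun x => by rw [huf, hvf]), bExpect_add, bExpect_add,
      bExpect_smul]
    have hcs := bExpect_cs (fun x => u x ^ 2) (fun x => v x ^ 2)
    simp only [← pow_mul] at hcs
    norm_num at hcs
    change bExpect (fun x => u x ^ 4) ≤ A ^ 2 at hA
    change bExpect (fun x => v x ^ 4) ≤ B ^ 2 at hB
    have huv : bExpect (fun x => u x ^ 2 * v x ^ 2) ≤ A * B := by
      apply le_of_sq_le_sq _ (mul_nonneg hA0 hB0)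
      refine hcs.trans ?_
      rw [mul_pow]
      exact mul_le_mul hA hB (bExpect_nonneg _ fun x => by positivity) (by positivity)
    nlinarith [mul_nonneg hA0 hB0, sq_nonneg B]

lemma sum_chi {n : ℕ} (x y : Fin n → Bool) :
    ∑ S : Finset (Fin n), bChi S x * bChi S y = if x = y then 2 ^ n else 0 := by
  have h1 : ∑ S : Finset (Fin n), bChi S x * bChi S y
      = ∏ i : Fin n, (1 + bSgn (x i) * bSgn (y i)) := by
    rw [Finset.prod_one_add, Finset.powerset_univ]
    refine Finset.sum_congr rfl fun S _ => ?_
    simp only [bChi, Finset.prod_mul_distrib]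
  rw [h1]
  split_ifs with h
  · subst h
    have : ∀ i, 1 + bSgn (x i) * bSgn (x i) = 2 := fun i => by
      have := bSgn_sq (x i); nlinarith
    simp [this]
  · obtain ⟨i, hi⟩ := Function.ne_iff.1 h
    apply Finset.prod_eq_zero (Finset.mem_univ i)
    revert hi
    cases x i <;> cases y i <;> simp [bSgn]

lemma parseval {n : ℕ} (f : (Fin n → Bool) → ℝ) :
    ∑ S : Finset (Fin n), bFourier f S ^ 2 = bExpect (fun x => f x ^ 2) := by
  have h1 : ∀ S : Finset (Fin n), bFourier f S ^ 2
      = (∑ x, ∑ y, f x * f y * (bChi S x * bChi S y)) / (2 ^ n * 2 ^ n) := by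
    intro S
    unfold bFourier bExpect
    rw [sq, div_mul_div_comm, Finset.sum_mul_sum]
    congr 1
    refine Finset.sum_congr rfl fun x _ => Finset.sum_congr rfl fun y _ => ?_
    ring
  simp only [h1]
  rw [← Finset.sum_div, Finset.sum_comm]
  have h2 : ∀ x : Fin n → Bool, ∑ S : Finset (Fin n), ∑ y, f x * f y * (bChi S x * bChi S y)
      = f x ^ 2 * 2 ^ n := by
    intro x
    rw [Finset.sum_comm]
    simp only [← Finset.mul_sum, sum_chi]
    simp [sq]
  simp only [h2]
  rw [← Finset.sum_mul]
  unfold bExpect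
  rw [mul_div_mul_right _ _ (by positivity)]

lemma expect_mul_sum {n : ℕ} (g : (Fin n → Bool) → ℝ) (a : Finset (Fin n) → ℝ) :
    bExpect (fun x => g x * ∑ S, a S * bChi S x) = ∑ S, a S * bFourier g S := by
  unfold bFourier bExpect
  simp only [Finset.mul_sum, mul_div_assoc']
  rw [Finset.sum_comm, ← Finset.sum_div]
  congr 1
  refine Finset.sum_congr rfl fun S _ => Finset.sum_congr rfl fun x _ => ?_
  ring

/-- low-degree weight of a `{-1,0,1}`-valued function -/
lemma level_ineq {n : ℕ} (g : (Fin n → Bool) → ℝ) (hg : ∀ x, g x ^ 4 = g x ^ 2) (d : ℕ) :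
    (∑ S ∈ univ.filter (fun S : Finset (Fin n) => S.card ≤ d), bFourier g S ^ 2) ^ 2
      ≤ bExpect (fun x => g x ^ 2) ^ 3 * 9 ^ d := by
  set w := ∑ S ∈ univ.filter (fun S : Finset (Fin n) => S.card ≤ d), bFourier g S ^ 2 with hw
  set E := bExpect (fun x => g x ^ 2) with hE
  have hE0 : 0 ≤ E := bExpect_nonneg _ fun x => by positivity
  have hw0 : 0 ≤ w := Finset.sum_nonneg fun S _ => by positivity
  set a : Finset (Fin n) → ℝ := fun S => if S.card ≤ d then bFourier g S else 0 with ha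
  set p : (Fin n → Bool) → ℝ := fun x => ∑ S, a S * bChi S x with hp
  have h1 : bExpect (fun x => g x * p x) = w := by
    rw [hp, expect_mul_sum, hw, Finset.sum_filter]
    refine Finset.sum_congr rfl fun S _ => ?_
    simp only [ha]
    split_ifs <;> ring
  have h2 : bExpect (fun x => p x ^ 4) ≤ (3 ^ d * w) ^ 2 := by
    have := bonami (univ : Finset (Fin n)) a
    rw [Finset.powerset_univ] at this
    refine this.trans ?_
    have h0 : 0 ≤ ∑ S : Finset (Fin n), 3 ^ S.card * a S ^ 2 :=
      Finset.sum_nonneg fun S _ => by positivity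
    refine pow_le_pow_left₀ h0 ?_ 2
    rw [hw, Finset.sum_filter, Finset.mul_sum]
    refine Finset.sum_le_sum fun S _ => ?_
    simp only [ha]
    split_ifs with h
    · gcongr
      norm_num
    · simp
  have h3 : w ^ 2 ≤ E * bExpect (fun x => g x ^ 2 * p x ^ 2) := by
    have hc := bExpect_cs (fun x => g x) (fun x => g x ^ 2 * p x)
    have e1 : ∀ x, g x * (g x ^ 2 * p x) = g x * p x := by
      intro x
      have : g x ^ 3 = g x := by
        have h := hg x
        by_cases h0 : g x = 0
        · simp [h0]
        · apply mul_left_cancel₀ h0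
          linarith [h, show g x * g x ^ 3 = g x ^ 4 by ring, show g x * g x = g x ^ 2 by ring]
      linear_combination p x * this
    have e2 : ∀ x, (g x ^ 2 * p x) ^ 2 = g x ^ 2 * p x ^ 2 := by
      intro x
      linear_combination p x ^ 2 * hg x
    simp only [e1, e2] at hc
    rw [h1] at hc
    exact hc
  have h4 : bExpect (fun x => g x ^ 2 * p x ^ 2) ^ 2 ≤ E * (3 ^ d * w) ^ 2 := by
    have hc := bExpect_cs (fun x => g x ^ 2) (fun x => p x ^ 2)
    have e1 : ∀ x, (g x ^ 2) ^ 2 = g x ^ 2 := fun x => by rw [← pow_mul]; exact hg x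
    have e2 : ∀ x, (p x ^ 2) ^ 2 = p x ^ 4 := fun x => by ring
    simp only [e1, e2] at hc
    exact hc.trans (mul_le_mul_of_nonneg_left h2 hE0)
  have h5 : (w ^ 2) ^ 2 ≤ (E ^ 3 * 9 ^ d) * w ^ 2 := by
    calc (w ^ 2) ^ 2 ≤ (E * bExpect (fun x => g x ^ 2 * p x ^ 2)) ^ 2 :=
          pow_le_pow_left₀ (by positivity) h3 2
      _ = E ^ 2 * bExpect (fun x => g x ^ 2 * p x ^ 2) ^ 2 := by ring
      _ ≤ E ^ 2 * (E * (3 ^ d * w) ^ 2) := by gcongr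
      _ = (E ^ 3 * 9 ^ d) * w ^ 2 := by
          rw [show (9 : ℝ) = 3 ^ 2 by norm_num, ← pow_mul]; ring
  rcases hw0.eq_or_lt with h | h
  · rw [← h, zero_pow two_ne_zero]; positivity
  · have : 0 < w ^ 2 := by positivity
    rw [sq (w ^ 2)] at h5
    exact le_of_mul_le_mul_right h5 this

noncomputable def bDer {n : ℕ} (f : (Fin n → Bool) → ℝ) (k : Fin n) (x : Fin n → Bool) : ℝ :=
  (f x - f (bFlip1 k x)) / 2

lemma bFourier_bDer {n : ℕ} (f : (Fin n → Bool) → ℝ) (k : Fin n) (S : Finset (Fin n)) :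
    bFourier (bDer f k) S = if k ∈ S then bFourier f S else 0 := by
  have h1 : bFourier (bDer f k) S
      = (1 / 2) * bFourier f S + (-1 / 2) * bExpect (fun x => f (bFlip1 k x) * bChi S x) := by
    unfold bFourier
    rw [← bExpect_smul, ← bExpect_smul, ← bExpect_add]
    congr 1
    funext x
    unfold bDer
    ring
  have h2 : bExpect (fun x => f (bFlip1 k x) * bChi S x)
      = bExpect (fun x => f x * bChi S (bFlip1 k x)) := by
    rw [← bExpect_flip k (fun x => f x * bChi S (bFlip1 k x))]
    congr 1
    funext x
    simp only [bFlip1_invol k x]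
  rw [h1, h2]
  split_ifs with h
  · have : (fun x => f x * bChi S (bFlip1 k x)) = fun x => (-1) * (f x * bChi S x) := by
      funext x; rw [bChi_flip_mem k S h]; ring
    rw [this, bExpect_smul]
    unfold bFourier; ring
  · have : (fun x => f x * bChi S (bFlip1 k x)) = fun x => (f x * bChi S x) := by
      funext x; rw [bChi_flip_not_mem k S h]
    rw [this]
    unfold bFourier; ring

lemma infl_level {n : ℕ} (f : (Fin n → Bool) → ℝ) (hf : IsBooleanFn f) (k : Fin n) (d : ℕ) :
    (∑ S : Finset (Fin n), if k ∈ S ∧ S.card ≤ d then bFourier f S ^ 2 else 0) ^ 2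
      ≤ inflS f k ^ 3 * 9 ^ d := by
  have h := level_ineq (bDer f k) (fun x => by
    unfold bDer
    rcases hf x with h | h <;> rcases hf (bFlip1 k x) with h' | h' <;> rw [h, h'] <;> norm_num) d
  rw [← parseval] at h
  have e1 : ∑ S, bFourier (bDer f k) S ^ 2 = inflS f k := by
    unfold inflS
    rw [Finset.sum_filter]
    refine Finset.sum_congr rfl fun S _ => ?_
    rw [bFourier_bDer]; split_ifs <;> simp
  have e2 : ∑ S ∈ univ.filter (fun S : Finset (Fin n) => S.card ≤ d), bFourier (bDer f k) S ^ 2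
      = ∑ S : Finset (Fin n), if k ∈ S ∧ S.card ≤ d then bFourier f S ^ 2 else 0 := by
    rw [Finset.sum_filter]
    refine Finset.sum_congr rfl fun S _ => ?_
    rw [bFourier_bDer]
    by_cases h1 : k ∈ S <;> by_cases h2 : S.card ≤ d <;> simp [h1, h2]
  rw [e1, e2] at h
  exact h

lemma totInfl_eq {n : ℕ} (f : (Fin n → Bool) → ℝ) : ∑ k, inflS f k = totInfl f := by
  unfold inflS totInfl
  simp only [Finset.sum_filter]
  rw [Finset.sum_comm]
  refine Finset.sum_congr rfl fun S _ => ?_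
  rw [← Finset.sum_filter, Finset.sum_const, nsmul_eq_mul]
  simp

lemma card_small {α : Type*} [DecidableEq α] (J : Finset α) (d : ℕ) :
    (J.powerset.filter (fun S => S.card ≤ d)).card ≤ (J.card + 1) ^ d := by
  induction d with
  | zero =>
    have : J.powerset.filter (fun S => S.card ≤ 0) ⊆ {∅} := by
      intro S hS
      simp at hS
      simp [hS.2]
    simpa using Finset.card_le_card this
  | succ d ih =>
    set F := J.powerset.filter (fun S => S.card ≤ d) with hF
    have hsub : J.powerset.filter (fun S => S.card ≤ d + 1)
        ⊆ F ∪ (J ×ˢ F).image (fun q => insert q.1 q.2) := by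
      intro S hS
      rw [Finset.mem_filter, Finset.mem_powerset] at hS
      rw [Finset.mem_union]
      by_cases h : S.card ≤ d
      · left; rw [hF, Finset.mem_filter, Finset.mem_powerset]; exact ⟨hS.1, h⟩
      · right
        have hne : S.Nonempty := Finset.card_pos.1 (by omega)
        obtain ⟨i, hi⟩ := hne
        rw [Finset.mem_image]
        refine ⟨(i, S.erase i), ?_, Finset.insert_erase hi⟩
        rw [Finset.mem_product, hF, Finset.mem_filter, Finset.mem_powerset]
        refine ⟨hS.1 hi, (Finset.erase_subset i S).trans hS.1, ?_⟩
        rw [Finset.card_erase_of_mem hi]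
        omega
    calc _ ≤ _ := Finset.card_le_card hsub
      _ ≤ F.card + ((J ×ˢ F).image (fun q => insert q.1 q.2)).card := Finset.card_union_le _ _
      _ ≤ F.card + (J ×ˢ F).card := Nat.add_le_add_left Finset.card_image_le _
      _ = (J.card + 1) * F.card := by rw [Finset.card_product]; ring
      _ ≤ (J.card + 1) * (J.card + 1) ^ d := Nat.mul_le_mul_left _ ih
      _ = (J.card + 1) ^ (d + 1) := by ring

/-- existence of a large set of coefficients carried by few sets -/
lemma concentration {n : ℕ} (f : (Fin n → Bool) → ℝ) (hf : IsBooleanFn f) (hI : 0 < totInfl f)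
    (d : ℕ) (hd : 4 * totInfl f ≤ d) :
    ∃ J : Finset (Fin n), (J.card : ℝ) ≤ 16 * totInfl f ^ 3 * 9 ^ d ∧
      1 / 2 ≤ ∑ S ∈ J.powerset.filter (fun S => S.card ≤ d), bFourier f S ^ 2 := by
  set I := totInfl f with hIdef
  set t : ℝ := 1 / (4 * 3 ^ d * I) with ht
  have ht0 : 0 < t := by positivity
  have hinf0 : ∀ k, 0 ≤ inflS f k := fun k => Finset.sum_nonneg fun S _ => by positivity
  set J : Finset (Fin n) := univ.filter (fun k => t ^ 2 ≤ inflS f k) with hJ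
  refine ⟨J, ?_, ?_⟩
  · have h1 : (J.card : ℝ) * t ^ 2 ≤ I := by
      rw [hIdef, ← totInfl_eq, ← nsmul_eq_mul]
      refine (Finset.card_nsmul_le_sum J (inflS f) (t ^ 2) ?_).trans ?_
      · intro k hk
        exact (Finset.mem_filter.1 hk).2
      · exact Finset.sum_le_sum_of_subset_of_nonneg (Finset.subset_univ _) fun k _ _ => hinf0 k
    have h2 : (J.card : ℝ) ≤ I / t ^ 2 := (le_div_iff₀ (by positivity)).2 h1
    refine h2.trans (le_of_eq ?_)
    rw [ht, show (9 : ℝ) = 3 ^ 2 by norm_num, ← pow_mul]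
    field_simp
    ring
  · have hsum1 : ∑ S : Finset (Fin n), bFourier f S ^ 2 = 1 := by
      rw [parseval]
      have : (fun x => f x ^ 2) = fun _ => (1 : ℝ) := by
        funext x
        rcases hf x with h | h <;> rw [h] <;> norm_num
      rw [this, bExpect_const]
    set w : Fin n → ℝ := fun k =>
      ∑ S : Finset (Fin n), if k ∈ S ∧ S.card ≤ d then bFourier f S ^ 2 else 0 with hw
    have hwk : ∀ k ∈ Jᶜ, w k ≤ inflS f k * (1 / (4 * I)) := by
      intro k hk
      have hk' : inflS f k ≤ t ^ 2 := by
        have : ¬ t ^ 2 ≤ inflS f k := by simpa [hJ] using hk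
        exact (not_le.1 this).le
      have h0 := hinf0 k
      have e : inflS f k * (1 / (4 * I)) = inflS f k * t * 3 ^ d := by
        rw [ht]; field_simp
      rw [e]
      refine le_of_sq_le_sq ?_ (by positivity)
      refine (infl_level f hf k d).trans ?_
      calc inflS f k ^ 3 * 9 ^ d = inflS f k ^ 2 * inflS f k * 9 ^ d := by ring
        _ ≤ inflS f k ^ 2 * t ^ 2 * 9 ^ d := by gcongr
        _ = (inflS f k * t * 3 ^ d) ^ 2 := by
          rw [show (9 : ℝ) = 3 ^ 2 by norm_num, ← pow_mul]; ring
    have hB : ∑ k ∈ Jᶜ, w k ≤ 1 / 4 := by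
      calc ∑ k ∈ Jᶜ, w k ≤ ∑ k ∈ Jᶜ, inflS f k * (1 / (4 * I)) := Finset.sum_le_sum hwk
        _ ≤ ∑ k, inflS f k * (1 / (4 * I)) :=
          Finset.sum_le_sum_of_subset_of_nonneg (Finset.subset_univ _)
            fun k _ _ => mul_nonneg (hinf0 k) (by positivity)
        _ = 1 / 4 := by
          rw [← Finset.sum_mul, totInfl_eq, ← hIdef]; field_simp
    have hpt : ∀ S : Finset (Fin n), bFourier f S ^ 2
        ≤ (if S ⊆ J ∧ S.card ≤ d then bFourier f S ^ 2 else 0)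
          + (S.card : ℝ) * bFourier f S ^ 2 * (1 / (4 * I))
          + ∑ k ∈ Jᶜ, if k ∈ S ∧ S.card ≤ d then bFourier f S ^ 2 else 0 := by
      intro S
      have hb : 0 ≤ (S.card : ℝ) * bFourier f S ^ 2 * (1 / (4 * I)) := by positivity
      have hc : ∀ k ∈ Jᶜ, (0 : ℝ) ≤ if k ∈ S ∧ S.card ≤ d then bFourier f S ^ 2 else 0 := by
        intro k _; split_ifs <;> positivity
      have hc' := Finset.sum_nonneg hc
      by_cases h1 : S.card ≤ d
      · by_cases h2 : S ⊆ J
        · rw [if_pos ⟨h2, h1⟩]; linarith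
        · rw [if_neg (fun h => h2 h.1)]
          obtain ⟨k, hkS, hkJ⟩ := Finset.not_subset.1 h2
          have := Finset.single_le_sum hc (Finset.mem_compl.2 hkJ)
          rw [if_pos ⟨hkS, h1⟩] at this
          linarith
      · rw [if_neg (fun h => h1 h.2)]
        have h3 : 4 * I ≤ (S.card : ℝ) := hd.trans (by exact_mod_cast (not_le.1 h1).le)
        have h4 : bFourier f S ^ 2 ≤ (S.card : ℝ) * bFourier f S ^ 2 * (1 / (4 * I)) := by
          rw [mul_one_div, le_div_iff₀ (by positivity), mul_comm]
          exact mul_le_mul_of_nonneg_right h3 (by positivity)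
        linarith
    have htot := Finset.sum_le_sum (s := univ) fun S _ => hpt S
    rw [hsum1, Finset.sum_add_distrib, Finset.sum_add_distrib, ← Finset.sum_mul,
      Finset.sum_comm, ← Finset.sum_filter] at htot
    have e1 : univ.filter (fun S : Finset (Fin n) => S ⊆ J ∧ S.card ≤ d)
        = J.powerset.filter (fun S => S.card ≤ d) := by
      ext S; simp
    have e2 : (∑ S : Finset (Fin n), (S.card : ℝ) * bFourier f S ^ 2) * (1 / (4 * I)) = 1 / 4 := by
      change I * _ = _
      field_simp
    rw [e1, e2] at htot
    change _ ≤ _ + _ + ∑ k ∈ Jᶜ, w k at htot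
    linarith

theorem fmei_from_friedgut (δ : ℝ) (hδ : 0 < δ) :
    ∃ c : ℝ, 0 < c ∧ ∀ (n : ℕ) (f : (Fin n → Bool) → ℝ), IsBooleanFn f →
      δ < totInfl f →
      ∃ S : Finset (Fin n), Real.exp (-c * totInfl f ^ 2) ≤ |bFourier f S| := by
  set L : ℝ := 4 + 1 / δ with hL
  have hL0 : 0 < L := by positivity
  set c : ℝ := (L * (9 + 3 * L) + 1 / δ ^ 2) / 2 with hc
  refine ⟨c, by positivity, fun n f hf hI => ?_⟩
  have hI0 : 0 < totInfl f := hδ.trans hI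
  set I := totInfl f with hIdef
  set d : ℕ := ⌈4 * I⌉₊ with hd
  have hd1 : 4 * I ≤ d := Nat.le_ceil _
  have hd2 : (d : ℝ) ≤ L * I := by
    have h1 : (d : ℝ) < 4 * I + 1 := Nat.ceil_lt_add_one (by positivity)
    have h2 : 1 ≤ 1 / δ * I := by
      rw [one_div_mul_eq_div, le_div_iff₀ hδ]; linarith
    rw [hL]; linarith
  obtain ⟨J, hJ, hsum⟩ := concentration f hf hI0 d hd1
  rw [← hIdef] at hJ
  by_contra hcon
  push Not at hcon
  set G := J.powerset.filter (fun S => S.card ≤ d) with hG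
  have hGne : G.Nonempty := by
    rw [Finset.nonempty_iff_ne_empty]
    intro h
    rw [h, Finset.sum_empty] at hsum
    norm_num at hsum
  have hlt : ∑ S ∈ G, bFourier f S ^ 2 < G.card * Real.exp (-c * I ^ 2) ^ 2 := by
    rw [← nsmul_eq_mul, ← Finset.sum_const]
    refine Finset.sum_lt_sum_of_nonempty hGne fun S _ => ?_
    rw [← sq_abs (bFourier f S)]
    exact pow_lt_pow_left₀ (hcon S) (abs_nonneg _) two_ne_zero
  have he3 : (9 : ℝ) ≤ Real.exp 3 := by
    have h1 := Real.exp_one_gt_d9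
    have h2 : Real.exp 3 = Real.exp 1 ^ 3 := by rw [← Real.exp_nat_mul]; norm_num
    rw [h2]
    calc (9 : ℝ) ≤ 2.7 ^ 3 := by norm_num
      _ ≤ _ := pow_le_pow_left₀ (by norm_num) (by linarith) 3
  have hcard : (J.card : ℝ) + 1 ≤ Real.exp (9 * I + 3 * d) := by
    have h9 : (1 : ℝ) ≤ 9 ^ d := one_le_pow₀ (by norm_num)
    calc (J.card : ℝ) + 1 ≤ (1 + 16 * I ^ 3) * 9 ^ d := by nlinarith
      _ ≤ (3 * I + 1) ^ 3 * 9 ^ d := by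
        gcongr
        nlinarith [pow_pos hI0 3, pow_pos hI0 2]
      _ ≤ Real.exp (3 * I) ^ 3 * Real.exp 3 ^ d := by
        gcongr
        exact Real.add_one_le_exp _
      _ = Real.exp (9 * I + 3 * d) := by
        rw [← Real.exp_nat_mul, ← Real.exp_nat_mul, ← Real.exp_add]
        congr 1; push_cast; ring
  have hGcard : (G.card : ℝ) ≤ Real.exp (L * (9 + 3 * L) * I ^ 2) := by
    calc (G.card : ℝ) ≤ ((J.card : ℝ) + 1) ^ d := by exact_mod_cast card_small J d
      _ ≤ Real.exp (9 * I + 3 * d) ^ d := by gcongr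
      _ = Real.exp (d * (9 * I + 3 * d)) := by rw [← Real.exp_nat_mul]
      _ ≤ Real.exp (L * (9 + 3 * L) * I ^ 2) := by
        rw [Real.exp_le_exp]
        calc (d : ℝ) * (9 * I + 3 * d) ≤ (L * I) * (9 * I + 3 * (L * I)) := by gcongr
          _ = _ := by ring
  have hfin : (G.card : ℝ) * Real.exp (-c * I ^ 2) ^ 2 ≤ 1 / 2 := by
    calc (G.card : ℝ) * Real.exp (-c * I ^ 2) ^ 2
        ≤ Real.exp (L * (9 + 3 * L) * I ^ 2) * Real.exp (-c * I ^ 2) ^ 2 := by gcongr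
      _ = Real.exp (-(1 / δ ^ 2 * I ^ 2)) := by
        rw [← Real.exp_nat_mul, ← Real.exp_add]
        congr 1; rw [hc]; push_cast; ring
      _ ≤ Real.exp (-1) := by
        rw [Real.exp_le_exp, neg_le_neg_iff, one_div_mul_eq_div, le_div_iff₀ (by positivity), one_mul]
        gcongr
      _ ≤ 1 / 2 := by
        rw [Real.exp_neg, one_div]
        exact inv_anti₀ (by norm_num) (by linarith [Real.exp_one_gt_d9])
  linarith
end
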